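/- arXiv:1412.6083 — 3 statements merged into one kernel-verified Lean document; each statement's English description precedes it below -/
import Mathlib

section
/- Let R be a finite ring with unity and A a finite (R,R)-bimodule which is a Frobenius bimodule, i.e., A ≅ R̂ both as left R-modules and as right R-modules. Then A has the extension property with respect to the symmetrized weight composition built on any subgroup G of Aut_R(A) (automorphisms of A as a left R-module). -/
open Function

/-- The annihilator of an element `a` of a left `R`-module, as a left ideal of `R`. -/
def elemAnn (R : Type*) [Ring R] {A : Type*} [AddCommGroup A] [Module R A] (a : A) :
    Submodule R R where
  carrier := {r | r • a = 0}
  add_mem' := fun {x y} hx hy => by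
    simp only [Set.mem_setOf_eq] at *; rw [add_smul, hx, hy, add_zero]
  zero_mem' := by simp
  smul_mem' := fun c r hr => by
    simp only [Set.mem_setOf_eq, smul_eq_mul] at *
    rw [mul_smul, hr, smul_zero]

/-- The symmetrized weight composition built on a subgroup `G ≤ Aut_R(A)`. -/
noncomputable def swc (R : Type*) [Ring R] {A : Type*} [AddCommGroup A] [Module R A]
    (G : Subgroup (A ≃ₗ[R] A)) {n : ℕ} (x : Fin n → A) (a : A) : ℕ :=
  Nat.card {i : Fin n // ∃ τ ∈ G, x i = τ a}

/-- The Hamming weight of a word. -/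
noncomputable def hwt {A : Type*} [Zero A] {n : ℕ} (x : Fin n → A) : ℕ :=
  Nat.card {i : Fin n // x i ≠ 0}

/-- The annihilator weight of a word. -/
noncomputable def aw (R : Type*) [Ring R] {A : Type*} [AddCommGroup A] [Module R A]
    {n : ℕ} (x : Fin n → A) (a : A) : ℕ :=
  Nat.card {i : Fin n // elemAnn R (x i) = elemAnn R a}

/-- `f : C → A^n` is the restriction of a `G`-monomial transformation of `A^n`. -/
def ExtendsToMonomial (R : Type*) [Ring R] {A : Type*} [AddCommGroup A] [Module R A]
    (G : Subgroup (A ≃ₗ[R] A)) {n : ℕ} (C : Submodule R (Fin n → A))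
    (f : C →ₗ[R] (Fin n → A)) : Prop :=
  ∃ (σ : Equiv.Perm (Fin n)) (τ : Fin n → G),
    ∀ (x : C) (i : Fin n), f x i = (τ i : A ≃ₗ[R] A) ((x : Fin n → A) (σ i))

/-- The extension property with respect to the symmetrized weight composition built on `G`. -/
def HasEPswc (R : Type*) [Ring R] (A : Type*) [AddCommGroup A] [Module R A]
    (G : Subgroup (A ≃ₗ[R] A)) : Prop :=
  ∀ (n : ℕ) (C : Submodule R (Fin n → A)) (f : C →ₗ[R] (Fin n → A)),
    Injective f → (∀ (x : C) (a : A), swc R G (f x) a = swc R G (x : Fin n → A) a) →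
    ExtendsToMonomial R G C f

/-- The extension property with respect to the Hamming weight. -/
def HasEPHamming (R : Type*) [Ring R] (A : Type*) [AddCommGroup A] [Module R A] : Prop :=
  ∀ (n : ℕ) (C : Submodule R (Fin n → A)) (f : C →ₗ[R] (Fin n → A)),
    Injective f → (∀ x : C, hwt (f x) = hwt (x : Fin n → A)) →
    ExtendsToMonomial R (⊤ : Subgroup (A ≃ₗ[R] A)) C f

/-- The extension property with respect to the annihilator weight. -/
def HasEPaw (R : Type*) [Ring R] (A : Type*) [AddCommGroup A] [Module R A] : Prop :=
  ∀ (n : ℕ) (C : Submodule R (Fin n → A)) (f : C →ₗ[R] (Fin n → A)),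
    Injective f → (∀ (x : C) (a : A), aw R (f x) a = aw R (x : Fin n → A) a) →
    ExtendsToMonomial R (⊤ : Subgroup (A ≃ₗ[R] A)) C f

/-- A module is pseudo-injective if every injective linear map from a submodule into the
module extends to an endomorphism. -/
def PseudoInjective (R : Type*) [Ring R] (A : Type*) [AddCommGroup A] [Module R A] : Prop :=
  ∀ (B : Submodule R A) (g : B →ₗ[R] A), Injective g →
    ∃ h : A →ₗ[R] A, ∀ b : B, h b = g b

/-- `A` embeds, as a left `R`-module, into the character module
`R̂ = Hom((R,+), ℚ/ℤ)` with `(r • χ) x = χ (x * r)`. -/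
def EmbedsInCharacterModule (R : Type*) [Ring R] (A : Type*) [AddCommGroup A]
    [Module R A] : Prop :=
  ∃ ι : A →+ (R →+ AddCircle (1 : ℚ)),
    Injective ι ∧ ∀ (r : R) (a : A) (x : R), ι (r • a) x = ι a (x * r)

/-- A chain ring: the left ideals are linearly ordered by inclusion. -/
def IsChainRing (R : Type*) [Ring R] : Prop :=
  ∀ I J : Submodule R R, I ≤ J ∨ J ≤ I

/-- Two finite families with the same fibre cardinalities differ by a permutation. -/
theorem exists_perm_of_card_fiber_eq {ι Q : Type*} [Finite ι] {u v : ι → Q}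
    (h : ∀ q, Nat.card {i // u i = q} = Nat.card {i // v i = q}) :
    ∃ σ : Equiv.Perm ι, ∀ i, v (σ i) = u i :=
  ⟨Equiv.ofFiberEquiv fun q => (Finite.card_eq.mp (h q)).some, fun i => Equiv.ofFiberEquiv_map _ i⟩

/-- Two finite families whose formal sums of group translates agree are matched, up to the group
action, by a permutation. -/
theorem exists_perm_smul_of_sum_single_eq {ι Γ M : Type*} [Fintype ι] [Group Γ] [Fintype Γ]
    [MulAction Γ M] {u v : ι → M}
    (h : ∑ i, ∑ τ : Γ, Finsupp.single (τ • u i) (1 : ℂ) =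
      ∑ i, ∑ τ : Γ, Finsupp.single (τ • v i) (1 : ℂ)) :
    ∃ σ : Equiv.Perm ι, ∀ i, ∃ τ : Γ, u i = τ • v (σ i) := by
  classical
  let p : M → MulAction.orbitRel.Quotient Γ M := Quotient.mk''
  have hp : ∀ (τ : Γ) (m : M), p (τ • m) = p m := fun τ m =>
    Quotient.sound' (MulAction.mem_orbit m τ)
  have hsum : ∀ (w : ι → M) (q : MulAction.orbitRel.Quotient Γ M),
      Finsupp.mapDomain p (∑ i, ∑ τ : Γ, Finsupp.single (τ • w i) (1 : ℂ)) q =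
        Fintype.card Γ * Nat.card {i // p (w i) = q} := by
    intro w q
    simp only [Finsupp.mapDomain_finsetSum, Finsupp.mapDomain_single, hp, Finsupp.smul_apply,
      Finsupp.finsetSum_apply, Finsupp.single_apply, Finset.sum_const, Finset.card_univ, ← Finset.smul_sum, nsmul_eq_mul,
      Nat.card_eq_fintype_card, Fintype.card_subtype, Finset.sum_boole]
  obtain ⟨σ, hσ⟩ := exists_perm_of_card_fiber_eq (u := p ∘ u) (v := p ∘ v) fun q => by
    have hq := (hsum u q).symm.trans ((congrArg (fun m => Finsupp.mapDomain p m q) h).trans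
      (hsum v q))
    have hΓ : (Fintype.card Γ : ℂ) ≠ 0 := Nat.cast_ne_zero.mpr Fintype.card_ne_zero
    exact_mod_cast mul_left_cancel₀ hΓ hq
  refine ⟨σ, fun i => ?_⟩
  obtain ⟨τ, hτ⟩ := Quotient.exact' (hσ i).symm
  exact ⟨τ, hτ.symm⟩

/-- The complex character `q ↦ exp (2 π i q)` of `ℚ/ℤ`. -/
noncomputable def ratCircleChar : AddChar (AddCircle (1 : ℚ)) ℂ :=
  (Circle.coeHom.compAddChar (AddCircle.toCircle_addChar (T := (1 : ℝ)))).compAddMonoidHom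
    (QuotientAddGroup.map _ _ (Rat.castHom ℝ).toAddMonoidHom (by
      rw [AddSubgroup.zmultiples_le]; simp))

theorem ratCircleChar_injective : Injective ratCircleChar := by
  have hmap : Injective (QuotientAddGroup.map (AddSubgroup.zmultiples (1 : ℚ))
      (AddSubgroup.zmultiples (1 : ℝ)) (Rat.castHom ℝ).toAddMonoidHom (by
        rw [AddSubgroup.zmultiples_le]; simp)) := by
    rw [injective_iff_map_eq_zero]
    intro q
    induction q using QuotientAddGroup.induction_on with
    | H q =>
      intro h
      rw [QuotientAddGroup.map_mk, QuotientAddGroup.eq_zero_iff,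
        AddSubgroup.mem_zmultiples_iff] at h
      obtain ⟨k, hk⟩ := h
      rw [QuotientAddGroup.eq_zero_iff, AddSubgroup.mem_zmultiples_iff]
      refine ⟨k, Rat.cast_injective (α := ℝ) ?_⟩
      simpa using hk
  exact Subtype.val_injective.comp ((AddCircle.injective_toCircle one_ne_zero).comp hmap)

/-- Complex characters obtained from linear maps into a module embedding in the character module
of the ring are linearly independent. -/
theorem exists_addChar_linearIndependent {R A C : Type*} [Ring R] [AddCommGroup A] [Module R A]
    [AddCommGroup C] [Finite C] [Module R C] (hA : EmbedsInCharacterModule R A) :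
    ∃ ψ : AddChar A ℂ, LinearIndependent ℂ fun (g : C →ₗ[R] A) (x : C) => ψ (g x) := by
  obtain ⟨ι, hι, hsmul⟩ := hA
  let ψ : AddChar A ℂ :=
    ratCircleChar.compAddMonoidHom ((AddMonoidHom.eval (1 : R)).comp ι)
  refine ⟨ψ, ?_⟩
  refine (AddChar.linearIndependent C ℂ).comp
    (fun g : C →ₗ[R] A => ψ.compAddMonoidHom g.toAddMonoidHom) fun g h hgh => ?_
  ext x
  refine hι (AddMonoidHom.ext fun r => ?_)
  have key : ι (g (r • x)) 1 = ι (h (r • x)) 1 :=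
    ratCircleChar_injective (DFunLike.congr_fun hgh (r • x))
  simpa [hsmul] using key

/-- A finite module embedding in the character module of the ring has the extension property with
respect to the symmetrized weight composition built on any group of automorphisms. -/
theorem EmbedsInCharacterModule.hasEPswc {R A : Type*} [Ring R] [AddCommGroup A] [Finite A]
    [Module R A] (hA : EmbedsInCharacterModule R A) (G : Subgroup (A ≃ₗ[R] A)) :
    HasEPswc R A G := by
  classical
  intro n C f _ hf
  have : Finite (A ≃ₗ[R] A) := DFunLike.finite _
  have := Fintype.ofFinite G
  obtain ⟨ψ, hψ⟩ := exists_addChar_linearIndependent (C := C) hA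
  let u : Fin n → C →ₗ[R] A := fun i => LinearMap.proj i ∘ₗ f
  let v : Fin n → C →ₗ[R] A := fun i => LinearMap.proj i ∘ₗ C.subtype
  have hpt : ∀ x : C, ∃ σ : Equiv.Perm (Fin n), ∀ i, ∃ τ : G, f x i = τ • (x : Fin n → A) (σ i) := by
    intro x
    let p : A → MulAction.orbitRel.Quotient G A := Quotient.mk''
    have hp : ∀ a b : A, p a = p b ↔ ∃ τ ∈ G, a = τ b := fun a b => by
      rw [Quotient.eq'', MulAction.orbitRel_apply, MulAction.mem_orbit_iff]
      constructor
      · rintro ⟨τ, rfl⟩; exact ⟨τ, τ.2, rfl⟩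
      · rintro ⟨τ, hτ, rfl⟩; exact ⟨⟨τ, hτ⟩, rfl⟩
    obtain ⟨σ, hσ⟩ := exists_perm_of_card_fiber_eq (u := fun i => p (f x i))
      (v := fun i => p ((x : Fin n → A) i)) fun q => by
        induction q using Quotient.inductionOn' with
        | h a =>
          change Nat.card {i // p (f x i) = p a} = Nat.card {i // p ((x : Fin n → A) i) = p a}
          simp only [hp]
          exact hf x a
    refine ⟨σ, fun i => ?_⟩
    obtain ⟨τ, hτ, h⟩ := (hp _ _).1 (hσ i).symm
    exact ⟨⟨τ, hτ⟩, h⟩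
  obtain ⟨σ, hσ⟩ := exists_perm_smul_of_sum_single_eq (Γ := G) (u := u) (v := v) <| hψ <| by
    simp only [map_sum, Finsupp.linearCombination_single, one_smul]
    ext x
    simp only [Finset.sum_apply]
    obtain ⟨σ, hσ⟩ := hpt x
    rw [← Equiv.sum_comp σ (fun i => ∑ τ : G, ψ ((τ • v i) x))]
    refine Finset.sum_congr rfl fun i _ => ?_
    obtain ⟨τ, hτ⟩ := hσ i
    rw [← Equiv.sum_comp (Equiv.mulRight τ) fun τ' : G => ψ ((τ' • v (σ i)) x)]
    refine Finset.sum_congr rfl fun τ' _ => congrArg ψ ?_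
    change τ' • f x i = (τ' * τ) • (x : Fin n → A) (σ i)
    rw [hτ, mul_smul]
  choose τ hτ using hσ
  exact ⟨σ, τ, fun x i => LinearMap.congr_fun (hτ i) x⟩

/-- A Frobenius bimodule (a finite `(R,R)`-bimodule isomorphic to `R̂` both as a left and as a
right `R`-module) has the extension property with respect to the symmetrized weight composition
built on any subgroup `G` of `Aut_R(A)` (automorphisms as a left `R`-module). -/
theorem ep_swc_of_frobenius_bimodule
    (R : Type*) [Ring R] [Finite R] (A : Type*) [AddCommGroup A] [Finite A]
    [Module R A] [Module Rᵐᵒᵖ A] [SMulCommClass R Rᵐᵒᵖ A]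
    (hleft : ∃ ι : A ≃+ (R →+ AddCircle (1 : ℚ)),
      ∀ (r : R) (a : A) (x : R), ι (r • a) x = ι a (x * r))
    (hright : ∃ κ : A ≃+ (R →+ AddCircle (1 : ℚ)),
      ∀ (r : R) (a : A) (x : R), κ (MulOpposite.op r • a) x = κ a (r * x))
    (G : Subgroup (A ≃ₗ[R] A)) :
    HasEPswc R A G := by
  obtain ⟨ι, hι⟩ := hleft
  exact EmbedsInCharacterModule.hasEPswc ⟨ι.toAddMonoidHom, ι.injective, hι⟩ G
end

section
/- Let R be a finite chain ring (a finite ring with unity whose left ideals form a chain under inclusion) and A a finite pseudo-injective left R-module. Then A has the extension property with respect to the symmetrized weight composition built on Aut_R(A) if and only if A has the extension property with respect to Hamming weight. -/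
open Function

/-- Over a chain ring any two simple modules are isomorphic. -/
lemma IsChainRing.nonempty_linearEquiv_of_isSimpleModule {R : Type*} [Ring R]
    (hchain : IsChainRing R) (S T : Type*) [AddCommGroup S] [Module R S] [AddCommGroup T]
    [Module R T] [IsSimpleModule R S] [IsSimpleModule R T] : Nonempty (S ≃ₗ[R] T) := by
  obtain ⟨I, hI, ⟨e⟩⟩ := isSimpleModule_iff_quot_maximal.mp ‹IsSimpleModule R S›
  obtain ⟨J, hJ, ⟨e'⟩⟩ := isSimpleModule_iff_quot_maximal.mp ‹IsSimpleModule R T›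
  have hIJ : I = J := (hchain I J).elim (hI.eq_of_le hJ.ne_top)
    fun h => (hJ.eq_of_le hI.ne_top h).symm
  exact ⟨e.trans ((Submodule.quotEquivOfEq I J hIJ).trans e'.symm)⟩

/-- Every left ideal of a finite chain ring is principal. -/
lemma IsChainRing.exists_eq_span_singleton {R : Type*} [Ring R] [Finite R]
    (hchain : IsChainRing R) (J : Submodule R R) : ∃ r, J = Submodule.span R {r} := by
  obtain ⟨r, hr, hmax⟩ := (Set.toFinite (J : Set R)).exists_maximalFor
    (fun r => Submodule.span R {r}) _ ⟨0, J.zero_mem⟩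
  refine ⟨r, le_antisymm (fun s hs => ?_) (by simpa using hr)⟩
  have hsr : Submodule.span R {s} ≤ Submodule.span R {r} :=
    (hchain _ _).elim id fun h => hmax hs h
  exact hsr (Submodule.mem_span_singleton_self s)

/-- In a pseudo-injective module, a linear map between copies of one module extends to an
endomorphism. -/
lemma PseudoInjective.exists_comp_eq {R A M : Type*} [Ring R] [AddCommGroup A] [Module R A]
    [AddCommGroup M] [Module R M] (hpi : PseudoInjective R A) {φ ψ : M →ₗ[R] A}
    (hφ : Injective φ) (hψ : Injective ψ) : ∃ h : A →ₗ[R] A, ∀ m, h (φ m) = ψ m := by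
  let e := LinearEquiv.ofInjective φ hφ
  obtain ⟨h, hh⟩ := hpi (LinearMap.range φ) (ψ ∘ₗ e.symm.toLinearMap)
    (hψ.comp e.symm.injective)
  refine ⟨h, fun m => ?_⟩
  simpa [e] using hh (e m)

/-- If the range of `φ` is essential, the extension is an automorphism. -/
lemma PseudoInjective.exists_equiv_of_essential {R A M : Type*} [Ring R] [AddCommGroup A]
    [Finite A] [Module R A] [AddCommGroup M] [Module R M] (hpi : PseudoInjective R A)
    {φ ψ : M →ₗ[R] A} (hφ : Injective φ) (hψ : Injective ψ)
    (hess : ∀ L : Submodule R A, Disjoint (LinearMap.range φ) L → L = ⊥) :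
    ∃ τ : A ≃ₗ[R] A, ∀ m, τ (φ m) = ψ m := by
  obtain ⟨h, hh⟩ := hpi.exists_comp_eq hφ hψ
  have hinj : Injective h := by
    refine LinearMap.ker_eq_bot.mp (hess _ ?_)
    rw [Submodule.disjoint_def]
    rintro _ ⟨m, rfl⟩ hm
    rw [LinearMap.mem_ker, hh] at hm
    rw [hψ (hm.trans (map_zero ψ).symm), map_zero]
  exact ⟨LinearEquiv.ofBijective h (Finite.injective_iff_bijective.mp hinj), hh⟩

/-- Over a chain ring, two embeddings of a module in a finite pseudo-injective module differ by
an automorphism. -/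
lemma PseudoInjective.exists_equiv {R : Type*} {A M : Type*} [Ring R] (hchain : IsChainRing R)
    [AddCommGroup A] [Finite A] [Module R A] [AddCommGroup M] [Module R M]
    (hpi : PseudoInjective R A) {φ ψ : M →ₗ[R] A} (hφ : Injective φ) (hψ : Injective ψ) :
    ∃ τ : A ≃ₗ[R] A, ∀ m, τ (φ m) = ψ m := by
  suffices key : ∀ (k : ℕ) (B : Submodule R A), Nat.card A - Nat.card B = k →
      ∀ g : B →ₗ[R] A, Injective g → ∃ τ : A ≃ₗ[R] A, ∀ b : B, τ b = g b by
    let e := LinearEquiv.ofInjective φ hφ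
    obtain ⟨τ, hτ⟩ := key _ (LinearMap.range φ) rfl (ψ ∘ₗ e.symm.toLinearMap)
      (hψ.comp e.symm.injective)
    exact ⟨τ, fun m => by simpa [e] using hτ (e m)⟩
  intro k
  induction k using Nat.strong_induction_on with
  | _ k ih =>
  intro B hk g hg
  by_cases h₁ : ∀ L : Submodule R A, Disjoint (LinearMap.range B.subtype) L → L = ⊥
  · exact hpi.exists_equiv_of_essential B.injective_subtype hg h₁
  by_cases h₂ : ∀ L : Submodule R A, Disjoint (LinearMap.range g) L → L = ⊥
  · obtain ⟨τ, hτ⟩ := hpi.exists_equiv_of_essential hg B.injective_subtype h₂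
    exact ⟨τ.symm, fun b => by rw [LinearEquiv.symm_apply_eq, hτ]; rfl⟩
  push Not at h₁ h₂
  obtain ⟨L₁, hd₁, hL₁⟩ := h₁
  obtain ⟨L₂, hd₂, hL₂⟩ := h₂
  obtain ⟨S₁, hS₁, hle₁⟩ := (eq_bot_or_exists_atom_le L₁).resolve_left hL₁
  obtain ⟨S₂, hS₂, hle₂⟩ := (eq_bot_or_exists_atom_le L₂).resolve_left hL₂
  have := isSimpleModule_iff_isAtom.mpr hS₁
  have := isSimpleModule_iff_isAtom.mpr hS₂
  obtain ⟨e⟩ := hchain.nonempty_linearEquiv_of_isSimpleModule S₁ S₂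
  let Φ : (B × S₁) →ₗ[R] A := B.subtype.coprod S₁.subtype
  let Ψ : (B × S₁) →ₗ[R] A := g.coprod (S₂.subtype ∘ₗ e.toLinearMap)
  have hΦ : Injective Φ := by
    rw [← LinearMap.ker_eq_bot, LinearMap.ker_coprod_of_disjoint_range]
    · simp
    · exact hd₁.mono_right (by simpa using hle₁)
  have hΨ : Injective Ψ := by
    rw [← LinearMap.ker_eq_bot, LinearMap.ker_coprod_of_disjoint_range]
    · have hinj : Injective (S₂.subtype ∘ₗ e.toLinearMap) :=
        S₂.injective_subtype.comp e.injective
      rw [LinearMap.ker_eq_bot.mpr hg, LinearMap.ker_eq_bot.mpr hinj, Submodule.prod_bot]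
    · exact hd₂.mono_right ((LinearMap.range_comp_le_range _ _).trans (by simpa using hle₂))
  let E := LinearEquiv.ofInjective Φ hΦ
  have hcard : Nat.card (LinearMap.range Φ) = Nat.card B * Nat.card S₁ := by
    rw [← Nat.card_congr E.toEquiv, Nat.card_prod]
  have hS : 1 < Nat.card S₁ := by
    have := IsSimpleModule.nontrivial R S₁
    exact Finite.one_lt_card
  have hB : 0 < Nat.card B := Nat.card_pos
  have hA : Nat.card (LinearMap.range Φ) ≤ Nat.card A :=
    Nat.card_le_card_of_injective _ (LinearMap.range Φ).injective_subtype
  have hlt : Nat.card A - Nat.card (LinearMap.range Φ) < k := by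
    have : Nat.card B < Nat.card B * Nat.card S₁ := lt_mul_of_one_lt_right hB hS
    omega
  obtain ⟨τ, hτ⟩ := ih _ hlt _ rfl (Ψ ∘ₗ E.symm.toLinearMap) (hΨ.comp E.symm.injective)
  refine ⟨τ, fun b => ?_⟩
  simpa [E, Φ, Ψ] using hτ (E (b, 0))

lemma ker_toSpanSingleton_eq_elemAnn {R A : Type*} [Ring R] [AddCommGroup A] [Module R A]
    (a : A) : LinearMap.ker (LinearMap.toSpanSingleton R A a) = elemAnn R a := by
  ext r
  simp [elemAnn]

/-- Over a chain ring, two elements of a finite pseudo-injective module lie in the same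
`Aut_R(A)`-orbit iff they have the same annihilator. -/
lemma PseudoInjective.exists_equiv_iff_elemAnn_eq {R A : Type*} [Ring R]
    (hchain : IsChainRing R) [AddCommGroup A] [Finite A] [Module R A]
    (hpi : PseudoInjective R A) (a b : A) :
    (∃ τ : A ≃ₗ[R] A, a = τ b) ↔ elemAnn R a = elemAnn R b := by
  constructor
  · rintro ⟨τ, rfl⟩
    ext r
    simp [elemAnn, ← map_smul]
  · intro hab
    rw [← ker_toSpanSingleton_eq_elemAnn, ← ker_toSpanSingleton_eq_elemAnn] at hab
    let f := LinearMap.toSpanSingleton R A b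
    let g := LinearMap.toSpanSingleton R A a
    let ψ := (LinearMap.ker f).liftQ g hab.ge
    obtain ⟨τ, hτ⟩ := hpi.exists_equiv hchain (φ := (LinearMap.ker f).liftQ f le_rfl) (ψ := ψ)
      (LinearMap.ker_eq_bot.mp (Submodule.ker_liftQ_eq_bot _ _ _ le_rfl))
      (LinearMap.ker_eq_bot.mp (Submodule.ker_liftQ_eq_bot _ _ _ hab.le))
    refine ⟨τ, ?_⟩
    simpa [f, g, ψ] using (hτ (Submodule.Quotient.mk 1)).symm

lemma PseudoInjective.swc_top_eq_aw {R A : Type*} [Ring R]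
    (hchain : IsChainRing R) [AddCommGroup A] [Finite A] [Module R A]
    (hpi : PseudoInjective R A) {n : ℕ} (x : Fin n → A) (a : A) :
    swc R (⊤ : Subgroup (A ≃ₗ[R] A)) x a = aw R x a :=
  Nat.card_congr <| Equiv.subtypeEquivRight fun i => by
    simpa using hpi.exists_equiv_iff_elemAnn_eq hchain (x i) a

/-- Functions into a finite partial order whose upper sets `Ici` have preimages of equal size
have fibres of equal size. -/
lemma Nat.card_fiber_eq_of_card_le_eq {ι L : Type*} [Finite ι] [PartialOrder L] [Finite L]
    {u v : ι → L} (h : ∀ l, Nat.card {i // l ≤ u i} = Nat.card {i // l ≤ v i}) (l : L) :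
    Nat.card {i // u i = l} = Nat.card {i // v i = l} := by
  classical
  have := Fintype.ofFinite ι
  have := Fintype.ofFinite L
  simp only [Nat.card_eq_fintype_card, Fintype.card_subtype] at h ⊢
  have split (w : ι → L) (l : L) : Finset.card {i | l ≤ w i} =
      Finset.card {i | w i = l} + ∑ k with l < k, Finset.card {i | w i = k} := by
    rw [Finset.card_eq_sum_card_fiberwise (f := w) (t := {k | l ≤ k}) (by simp [Set.MapsTo])]
    have hset : ({k | l ≤ k} : Finset L) = insert l ({k | l < k} : Finset L) := by
      ext k
      simp [le_iff_eq_or_lt, eq_comm]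
    rw [hset, Finset.sum_insert (by simp)]
    congr 1
    · congr 1
      ext i
      simpa using fun hi => hi.ge
    · refine Finset.sum_congr rfl fun k hk => ?_
      congr 1
      ext i
      simp only [Finset.mem_filter, Finset.mem_univ, true_and] at hk ⊢
      exact ⟨And.right, fun hi => ⟨hi ▸ hk.le, hi⟩⟩
  induction l using WellFoundedGT.induction with
  | _ l ih =>
  have hl := h l
  rw [split u, split v,
    Finset.sum_congr rfl fun k hk => ih k (Finset.mem_filter.mp hk).2] at hl
  exact Nat.add_right_cancel hl

lemma hwt_add_card_eq_zero {A : Type*} [Zero A] {n : ℕ} (x : Fin n → A) :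
    hwt x + Nat.card {i // x i = 0} = n := by
  classical
  have h := Fintype.card_subtype_compl (fun i => x i = 0)
  have hle := Fintype.card_subtype_le (fun i => x i = 0)
  simp only [hwt, Nat.card_eq_fintype_card, Fintype.card_fin, ne_eq] at *
  omega

lemma swc_zero_eq_card {R A : Type*} [Ring R] [AddCommGroup A] [Module R A]
    (G : Subgroup (A ≃ₗ[R] A)) {n : ℕ} (x : Fin n → A) :
    swc R G x 0 = Nat.card {i // x i = 0} :=
  Nat.card_congr <| Equiv.subtypeEquivRight fun i => by
    simpa using fun _ => ⟨1, G.one_mem⟩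

/-- Over a finite chain ring, the Hamming weights of the multiples of a word determine its
annihilator weight. -/
lemma aw_eq_of_hwt_smul_eq {R A : Type*} [Ring R] [Finite R] (hchain : IsChainRing R)
    [AddCommGroup A] [Module R A] {n : ℕ} {x y : Fin n → A}
    (h : ∀ r : R, hwt (r • x) = hwt (r • y)) (a : A) : aw R x a = aw R y a := by
  refine Nat.card_fiber_eq_of_card_le_eq (u := fun i => elemAnn R (x i))
    (v := fun i => elemAnn R (y i)) (fun J => ?_) _
  obtain ⟨r, rfl⟩ := hchain.exists_eq_span_singleton J
  have count (z : Fin n → A) : Nat.card {i // Submodule.span R {r} ≤ elemAnn R (z i)} =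
      Nat.card {i // (r • z) i = 0} :=
    Nat.card_congr <| Equiv.subtypeEquivRight fun i => by
      rw [Submodule.span_singleton_le_iff_mem]
      rfl
  rw [count, count]
  have hx := hwt_add_card_eq_zero (r • x)
  have hy := hwt_add_card_eq_zero (r • y)
  have := h r
  omega

/-- Over a finite chain ring, for a finite pseudo-injective module the extension property with
respect to the symmetrized weight composition built on `Aut_R(A)` is equivalent to the extension
property with respect to Hamming weight. -/
theorem ep_swc_iff_ep_hamming_of_chainRing
    (R : Type*) [Ring R] [Finite R] (hchain : IsChainRing R)
    (A : Type*) [AddCommGroup A] [Finite A] [Module R A]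
    (hpi : PseudoInjective R A) :
    HasEPswc R A (⊤ : Subgroup (A ≃ₗ[R] A)) ↔ HasEPHamming R A := by
  constructor
  · intro hswc n C f hf hw
    refine hswc n C f hf fun x a => ?_
    rw [hpi.swc_top_eq_aw hchain, hpi.swc_top_eq_aw hchain]
    exact aw_eq_of_hwt_smul_eq hchain (fun r => by simpa using hw (r • x)) a
  · intro hham n C f hf hs
    refine hham n C f hf fun x => ?_
    have h₀ := hs x 0
    rw [swc_zero_eq_card, swc_zero_eq_card] at h₀
    have hfx := hwt_add_card_eq_zero (f x)
    have hx := hwt_add_card_eq_zero (x : Fin n → A)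
    omega
end

section
/- Let R = M_m(F_q) be the ring of m × m matrices over the finite field F_q and A a finite left R-module. If C ⊆ A^n is a linear code and f : C → A^n is an injective R-linear map preserving Hamming weight, then f preserves the annihilator weight aw: for every x ∈ C and a ∈ A, |{i : Ann(f(x)_i) = Ann(a)}| = |{i : Ann(x_i) = Ann(a)}|. -/
open Function

open Finset in
theorem card_filter_le_eq_add_sum {P ι : Type*} [PartialOrder P] [Fintype P] [Fintype ι]
    [DecidableEq P] [DecidableLE P] [DecidableLT P] (u : ι → P) (p : P) :
    #{i | p ≤ u i} = #{i | u i = p} + ∑ q with p < q, #{i | u i = q} := by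
  classical
  have hfib : ∑ q with p < q, #{i | u i = q} = #{i | p < u i} := by
    rw [card_eq_sum_card_fiberwise (f := u) (t := {q | p < q}) (by intro i; simp)]
    refine sum_congr rfl fun q hq => ?_
    rw [filter_filter]
    congr 1
    ext i
    simp only [mem_filter, mem_univ, true_and] at hq ⊢
    exact ⟨fun e => ⟨e ▸ hq, e⟩, fun e => e.2⟩
  rw [hfib, ← card_union_of_disjoint, ← filter_or]
  · congr 1
    ext i
    simp [le_iff_lt_or_eq, or_comm, eq_comm]
  · rw [disjoint_filter]
    rintro i - rfl
    exact lt_irrefl _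

open Finset in
/-- Two families in a finite partial order which meet every principal upper set equally often
take every value equally often. -/
theorem card_filter_eq_of_card_filter_le_eq {P ι κ : Type*} [PartialOrder P] [Finite P]
    [Fintype ι] [Fintype κ] [DecidableEq P] [DecidableLE P] (u : ι → P) (v : κ → P)
    (h : ∀ p, #{i | p ≤ u i} = #{j | p ≤ v j}) (p : P) :
    #{i | u i = p} = #{j | v j = p} := by
  classical
  have : Fintype P := Fintype.ofFinite P
  induction p using WellFoundedGT.induction with
  | _ p ih =>
    have hp := h p
    rw [card_filter_le_eq_add_sum u, card_filter_le_eq_add_sum v,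
      sum_congr rfl fun q hq => ih q (mem_filter.1 hq).2] at hp
    exact Nat.add_right_cancel hp

theorem mem_elemAnn {R A : Type*} [Ring R] [AddCommGroup A] [Module R A] {r : R} {a : A} :
    r ∈ elemAnn R a ↔ r • a = 0 :=
  Iff.rfl

/-- Over the matrix ring `M_m(F_q)`, an injective linear Hamming-weight-preserving map between
codes preserves the annihilator weight. -/
theorem aw_preserved_of_hamming_preserved_matrixRing
    (F : Type*) [Field F] [Fintype F] (m : ℕ)
    (A : Type*) [AddCommGroup A] [Finite A] [Module (Matrix (Fin m) (Fin m) F) A]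
    (n : ℕ) (C : Submodule (Matrix (Fin m) (Fin m) F) (Fin n → A))
    (f : C →ₗ[Matrix (Fin m) (Fin m) F] (Fin n → A))
    (hinj : Injective f) (hw : ∀ x : C, hwt (f x) = hwt (x : Fin n → A)) :
    ∀ (x : C) (a : A),
      aw (Matrix (Fin m) (Fin m) F) (f x) a =
        aw (Matrix (Fin m) (Fin m) F) (x : Fin n → A) a := by
  classical
  intro x a
  have hzero (y z : Fin n → A) (h : hwt y = hwt z) :
      Nat.card {i // y i = 0} = Nat.card {i // z i = 0} := by
    have hy := Fintype.card_subtype_compl fun i => y i = 0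
    have hz := Fintype.card_subtype_compl fun i => z i = 0
    have hy' := Fintype.card_subtype_le fun i => y i = 0
    have hz' := Fintype.card_subtype_le fun i => z i = 0
    simp only [hwt, Nat.card_eq_fintype_card, ne_eq] at h ⊢
    omega
  have hcount := card_filter_eq_of_card_filter_le_eq
    (fun i => elemAnn (Matrix (Fin m) (Fin m) F) (f x i))
    (fun i => elemAnn (Matrix (Fin m) (Fin m) F) ((x : Fin n → A) i)) ?_
    (elemAnn (Matrix (Fin m) (Fin m) F) a)
  · simpa [aw, Fintype.card_subtype] using hcount
  · intro I
    obtain ⟨r, rfl⟩ := (IsPrincipalIdealRing.principal I).principal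
    have hr := hzero _ _ (hw (r • x))
    rw [map_smul, Submodule.coe_smul] at hr
    simp only [Submodule.span_singleton_le_iff_mem]
    simpa [mem_elemAnn, Fintype.card_subtype] using hr
end
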